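/- arXiv:1009.1544 — 2 statements merged into one kernel-verified Lean document; each statement's English description precedes it below -/
import Mathlib

section
/- Let n and L be positive integers, let α₁ ∈ [0,1), α₂ ≥ 0 and ε ≥ 0 with α₂ ≤ ε·L. Let X and X̃ be subsets of {1,…,n} with |X| ≤ L and |X̃| ≤ L. Suppose that for every subset Q ⊆ {1,…,n} with |Q| ≤ L there exists a real number ã_Q such that both (1−α₁)·|X ∪ Q| − α₂ ≤ ã_Q ≤ (1+α₁)·|X ∪ Q| + α₂ and (1−α₁)·|X̃ ∪ Q| − α₂ ≤ ã_Q ≤ (1+α₁)·|X̃ ∪ Q| + α₂. Then the symmetric difference satisfies |X △ X̃| ≤ 16(α₁+ε)·L/(1−α₁). -/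
/-- If the bi-approximate answer intervals for `A ∪ Q` and `B ∪ Q` at the query `Q = A` meet,
then `B \ A` is small. -/
theorem mul_card_sdiff_le_of_approx_union {ι : Type*} [DecidableEq ι] {A B : Finset ι}
    {α β a : ℝ} (hA : a ≤ (1 + α) * ((A ∪ A).card : ℝ) + β)
    (hB : (1 - α) * ((B ∪ A).card : ℝ) - β ≤ a) :
    (1 - α) * ((B \ A).card : ℝ) ≤ 2 * α * A.card + 2 * β := by
  have hcard : ((B ∪ A).card : ℝ) = (B \ A).card + A.card := by
    exact_mod_cast (Finset.card_sdiff_add_card B A).symm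
  rw [Finset.union_self] at hA
  rw [hcard] at hB
  linarith

/-- Decoding from approximate union queries: any candidate set `X'` of size at most `L`
consistent with bi-approximate answers to all union queries of size at most `L`
is close in symmetric difference to the true set `X`. -/
theorem union_query_decoding (n L : ℕ) (hn : 0 < n) (hL : 0 < L)
    (α₁ α₂ ε : ℝ) (hα₁0 : 0 ≤ α₁) (hα₁1 : α₁ < 1) (hα₂ : 0 ≤ α₂) (hε : 0 ≤ ε)
    (hα₂L : α₂ ≤ ε * L)
    (X X' : Finset (Fin n)) (hX : X.card ≤ L) (hX' : X'.card ≤ L)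
    (h : ∀ Q : Finset (Fin n), Q.card ≤ L → ∃ aQ : ℝ,
      ((1 - α₁) * ((X ∪ Q).card : ℝ) - α₂ ≤ aQ ∧ aQ ≤ (1 + α₁) * ((X ∪ Q).card : ℝ) + α₂) ∧
      ((1 - α₁) * ((X' ∪ Q).card : ℝ) - α₂ ≤ aQ ∧
        aQ ≤ (1 + α₁) * ((X' ∪ Q).card : ℝ) + α₂)) :
    ((symmDiff X X').card : ℝ) ≤ 16 * (α₁ + ε) * L / (1 - α₁) := by
  have hXL : (X.card : ℝ) ≤ L := by exact_mod_cast hX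
  have hXL' : (X'.card : ℝ) ≤ L := by exact_mod_cast hX'
  obtain ⟨a, ⟨-, ha⟩, ha', -⟩ := h X hX
  obtain ⟨b, ⟨hb, -⟩, -, hb'⟩ := h X' hX'
  have hsdiff' := mul_card_sdiff_le_of_approx_union ha ha'
  have hsdiff := mul_card_sdiff_le_of_approx_union hb' hb
  have hcard : ((symmDiff X X').card : ℝ) = (X \ X').card + (X' \ X).card := by
    rw [symmDiff_def, Finset.sup_eq_union,
      Finset.card_union_of_disjoint disjoint_sdiff_sdiff, Nat.cast_add]
  have hαX := mul_le_mul_of_nonneg_left hXL hα₁0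
  have hαX' := mul_le_mul_of_nonneg_left hXL' hα₁0
  have hαL : 0 ≤ α₁ * (L : ℝ) := by positivity
  have hεL : 0 ≤ ε * (L : ℝ) := by positivity
  rw [le_div_iff₀ (by linarith), hcard]
  linarith
end

section
/- Let U be a finite set, H ⊆ U with |H| = K ≥ 1, let h be a positive integer, and let δ ∈ (0,1). If f is drawn uniformly at random from the set of all functions U → {1,…,h}, then with probability at least 1 − δ, |f(H)| ≥ (1 − K/(δ·h))·K, where f(H) = {f(i) : i ∈ H}. -/
open Finset in
/-- A map fails to be injective on `s` by at most the number of its collisions. -/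
theorem card_le_card_image_add_card_collisions {α β : Type*} [DecidableEq α] [DecidableEq β]
    (s : Finset α) (f : α → β) :
    #s ≤ #(s.image f) + #{p ∈ s.offDiag | f p.1 = f p.2} := by
  induction s using Finset.induction_on with
  | empty => simp
  | insert a s ha ih =>
    rw [card_insert_of_notMem ha, image_insert]
    have hsub : {p ∈ s.offDiag | f p.1 = f p.2} ⊆ {p ∈ (insert a s).offDiag | f p.1 = f p.2} :=
      filter_subset_filter _ (offDiag_mono (subset_insert a s))
    by_cases hfa : f a ∈ s.image f
    · obtain ⟨b, hb, hab⟩ := mem_image.1 hfa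
      have hlt : #{p ∈ s.offDiag | f p.1 = f p.2} <
          #{p ∈ (insert a s).offDiag | f p.1 = f p.2} := by
        refine card_lt_card (hsub.ssubset_of_mem_notMem (a := (a, b)) ?_ ?_)
        · have hne : a ≠ b := fun e => ha (e ▸ hb)
          simp [hb, hab, hne]
        · simp [ha]
      rw [insert_eq_of_mem hfa]
      omega
    · rw [card_insert_of_notMem hfa]
      have := card_le_card hsub
      omega

open Finset in
/-- Two distinct points collide under at most a `1 / |β|` fraction of all functions. -/
theorem card_filter_apply_eq_mul_card_le {α β : Type*} [Fintype α] [DecidableEq α] [Fintype β]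
    [DecidableEq β] {i j : α} (hij : i ≠ j) :
    #{f : α → β | f i = f j} * Fintype.card β ≤ Fintype.card (α → β) := by
  rw [← card_univ (α := β), ← card_product, ← card_univ (α := α → β)]
  refine card_le_card_of_injOn (fun p => Function.update p.1 i p.2) (by simp) ?_
  rintro ⟨f, c⟩ hf ⟨g, d⟩ hg heq
  simp only [coe_product, Set.mem_prod, mem_coe, mem_filter, mem_univ, true_and, and_true]
    at hf hg heq
  have hoff : ∀ k, k ≠ i → f k = g k := fun k hk => by
    simpa [Function.update_of_ne hk] using congrFun heq k
  have hcd : c = d := by simpa using congrFun heq i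
  have hfg : f = g := by
    funext k
    by_cases hk : k = i
    · rw [hk, hf, hg, hoff j hij.symm]
    · exact hoff k hk
  rw [hfg, hcd]

open Finset in
/-- The total number of collisions on `s`, over all functions. -/
theorem sum_card_collisions_mul_card_le {α β : Type*} [Fintype α] [DecidableEq α] [Fintype β]
    [DecidableEq β] (s : Finset α) :
    (∑ f : α → β, #{p ∈ s.offDiag | f p.1 = f p.2}) * Fintype.card β ≤
      #s ^ 2 * Fintype.card (α → β) := by
  simp_rw [card_filter]
  rw [sum_comm, sum_mul]
  calc _ ≤ ∑ _p ∈ s.offDiag, Fintype.card (α → β) := by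
        refine sum_le_sum fun p hp => ?_
        rw [← card_filter]
        exact card_filter_apply_eq_mul_card_le (mem_offDiag.1 hp).2.2
    _ ≤ _ := by
        rw [sum_const, smul_eq_mul, offDiag_card, sq]
        gcongr
        exact Nat.sub_le _ _


open Classical in
/-- Lemma 4.2: hashing `K = |H|` items into `h` buckets by a uniformly random
function separates all but a `K/(δh)` fraction of them, with probability `1 − δ`:
`P[|f(H)| ≥ (1 − K/(δh))·K] ≥ 1 − δ` under the uniform distribution on functions. -/
theorem image_card_high_probability {U : Type*} [Fintype U] [DecidableEq U]
    (H : Finset U) (K : ℕ) (hK : H.card = K) (hK1 : 1 ≤ K)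
    (h : ℕ) (hh : 0 < h) (δ : ℝ) (hδ0 : 0 < δ) (hδ1 : δ < 1) :
    1 - δ ≤
      ((Finset.univ.filter fun f : U → Fin h =>
            (1 - (K : ℝ) / (δ * (h : ℝ))) * (K : ℝ) ≤ ((H.image f).card : ℝ)).card : ℝ) /
        (Fintype.card (U → Fin h) : ℝ) := by
  subst hK
  have : NeZero h := ⟨hh.ne'⟩
  have hN : (0 : ℝ) < Fintype.card (U → Fin h) := by exact_mod_cast Fintype.card_pos
  have hh' : (0 : ℝ) < h := by exact_mod_cast hh
  have hK' : (0 : ℝ) < H.card := by exact_mod_cast hK1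
  set P : (U → Fin h) → Prop := fun f =>
    (1 - (H.card : ℝ) / (δ * (h : ℝ))) * (H.card : ℝ) ≤ ((H.image f).card : ℝ)
  set coll : (U → Fin h) → ℕ := fun f => (H.offDiag.filter fun p => f p.1 = f p.2).card
  have hsplit : ((Finset.univ.filter P).card : ℝ) + ((Finset.univ.filter fun f => ¬ P f).card : ℝ)
      = Fintype.card (U → Fin h) := by
    exact_mod_cast Finset.card_filter_add_card_filter_not (s := Finset.univ) P
  have hsum : (∑ f, (coll f : ℝ)) * h ≤ (H.card : ℝ) ^ 2 * Fintype.card (U → Fin h) := by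
    have := sum_card_collisions_mul_card_le (β := Fin h) H
    rw [Fintype.card_fin] at this
    exact_mod_cast this
  have hmarkov : ((Finset.univ.filter fun f => ¬ P f).card : ℝ) * ((H.card : ℝ) ^ 2 / (δ * h)) ≤
      ∑ f, (coll f : ℝ) := by
    rw [← nsmul_eq_mul]
    refine (Finset.card_nsmul_le_sum _ _ _ fun f hf => ?_).trans
      (Finset.sum_le_sum_of_subset_of_nonneg (Finset.subset_univ _) fun _ _ _ => Nat.cast_nonneg _)
    have hlt := not_le.1 (Finset.mem_filter.1 hf).2
    have hle : (H.card : ℝ) ≤ (H.image f).card + coll f := by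
      have := card_le_card_image_add_card_collisions H f
      exact_mod_cast this
    have hexp : (1 - (H.card : ℝ) / (δ * h)) * H.card = H.card - (H.card : ℝ) ^ 2 / (δ * h) := by
      ring
    linarith
  have hbad : ((Finset.univ.filter fun f => ¬ P f).card : ℝ) ≤ δ * Fintype.card (U → Fin h) := by
    have hprod := (mul_le_mul_of_nonneg_right hmarkov hh'.le).trans hsum
    have hrw : ((Finset.univ.filter fun f => ¬ P f).card : ℝ) * ((H.card : ℝ) ^ 2 / (δ * h)) * h =
        (H.card : ℝ) ^ 2 * (((Finset.univ.filter fun f => ¬ P f).card : ℝ) / δ) := by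
      field_simp
    rw [hrw] at hprod
    have := le_of_mul_le_mul_left hprod (by positivity)
    rwa [div_le_iff₀' hδ0] at this
  rw [le_div_iff₀ hN]
  linarith
end
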